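/- Let N = 3 and let η₁, η₂, η₃ ∈ ℂ. The classical r-matrix of the full chain of extended twists for sp(3,ℂ), r = Σ_{k=1}^{3} η_k ( H_{kk} ∧ E_{k+k} + Σ_{i=k+1}^{3} E_{k−i} ∧ E_{k+i} ), satisfies the classical Yang–Baxter equation in M₆(ℂ)⊗M₆(ℂ)⊗M₆(ℂ). -/

import Mathlib

/- Matrix units `e_{a,b}` of `M_{2N}(ℂ)`, with 1-based indices `1 ≤ a, b ≤ 2N`
   (out-of-range indices give the zero matrix). -/
noncomputable def eM (N a b : ℕ) : Matrix (Fin (2*N)) (Fin (2*N)) ℂ :=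
  Matrix.of fun p q => if p.val + 1 = a ∧ q.val + 1 = b then 1 else 0

/-- `H_{kk} = (1/2)(e_{k,k} - e_{N+k,N+k})`, `1 ≤ k ≤ N`. -/
noncomputable def Hgen (N k : ℕ) : Matrix (Fin (2*N)) (Fin (2*N)) ℂ :=
  (1/2 : ℂ) • (eM N k k - eM N (N+k) (N+k))

/-- `E_{k+i} = e_{k,N+i} + e_{i,N+k}` (so `E_{k+k} = 2 e_{k,N+k}`), `1 ≤ k ≤ i ≤ N`. -/
noncomputable def Ep (N k i : ℕ) : Matrix (Fin (2*N)) (Fin (2*N)) ℂ :=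
  eM N k (N+i) + eM N i (N+k)

/-- `E_{k−i} = e_{k,i} - e_{N+i,N+k}`, `1 ≤ k < i ≤ N`. -/
noncomputable def Em (N k i : ℕ) : Matrix (Fin (2*N)) (Fin (2*N)) ℂ :=
  eM N k i - eM N (N+i) (N+k)

open TensorProduct

/-- `r₁₂ : x ⊗ y ↦ (x ⊗ y) ⊗ 1`. -/
noncomputable def emb12 (A : Type) [Ring A] [Algebra ℂ A] :
    (A ⊗[ℂ] A) →ₐ[ℂ] (A ⊗[ℂ] A) ⊗[ℂ] A :=
  Algebra.TensorProduct.includeLeft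

/-- `r₁₃ : x ⊗ y ↦ (x ⊗ 1) ⊗ y`. -/
noncomputable def emb13 (A : Type) [Ring A] [Algebra ℂ A] :
    (A ⊗[ℂ] A) →ₐ[ℂ] (A ⊗[ℂ] A) ⊗[ℂ] A :=
  Algebra.TensorProduct.map Algebra.TensorProduct.includeLeft (AlgHom.id ℂ A)

/-- `r₂₃ : x ⊗ y ↦ (1 ⊗ x) ⊗ y`. -/
noncomputable def emb23 (A : Type) [Ring A] [Algebra ℂ A] :
    (A ⊗[ℂ] A) →ₐ[ℂ] (A ⊗[ℂ] A) ⊗[ℂ] A :=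
  Algebra.TensorProduct.map Algebra.TensorProduct.includeRight (AlgHom.id ℂ A)

/-- The classical Yang–Baxter equation `[r₁₂,r₁₃] + [r₁₂,r₂₃] + [r₁₃,r₂₃] = 0`,
with the commutator bracket `[X,Y] = XY − YX`. -/
def CYBE (A : Type) [Ring A] [Algebra ℂ A] (r : A ⊗[ℂ] A) : Prop :=
  (emb12 A r * emb13 A r - emb13 A r * emb12 A r) +
  (emb12 A r * emb23 A r - emb23 A r * emb12 A r) +
  (emb13 A r * emb23 A r - emb23 A r * emb13 A r) = 0

/-- `x ∧ y := x ⊗ y − y ⊗ x`. -/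
noncomputable def wedge {A : Type} [Ring A] [Algebra ℂ A] (x y : A) : A ⊗[ℂ] A :=
  x ⊗ₜ[ℂ] y - y ⊗ₜ[ℂ] x

/-- The polarisation `[r₁₂,s₁₃] + [r₁₂,s₂₃] + [r₁₃,s₂₃]` of the left side of the classical
Yang–Baxter equation. -/
noncomputable def cybeBracket {A : Type} [Ring A] [Algebra ℂ A] (r s : A ⊗[ℂ] A) :
    (A ⊗[ℂ] A) ⊗[ℂ] A :=
  (emb12 A r * emb13 A s - emb13 A s * emb12 A r) +
  (emb12 A r * emb23 A s - emb23 A s * emb12 A r) +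
  (emb13 A r * emb23 A s - emb23 A s * emb13 A r)

/-- The adjoint action of `x` on `A ⊗ A`. -/
noncomputable def adTensor {A : Type} [Ring A] [Algebra ℂ A] (x : A) (u : A ⊗[ℂ] A) : A ⊗[ℂ] A :=
  (x ⊗ₜ[ℂ] 1 + 1 ⊗ₜ[ℂ] x) * u - u * (x ⊗ₜ[ℂ] 1 + 1 ⊗ₜ[ℂ] x)

/-- The alternating insertion `a ⊗ b ↦ a ⊗ b ⊗ y - a ⊗ y ⊗ b + y ⊗ a ⊗ b`. -/
noncomputable def insertTensor {A : Type} [Ring A] [Algebra ℂ A] (y : A) (u : A ⊗[ℂ] A) :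
    (A ⊗[ℂ] A) ⊗[ℂ] A :=
  emb12 A u * ((1 ⊗ₜ[ℂ] 1) ⊗ₜ[ℂ] y) - emb13 A u * ((1 ⊗ₜ[ℂ] y) ⊗ₜ[ℂ] 1) +
    emb23 A u * ((y ⊗ₜ[ℂ] 1) ⊗ₜ[ℂ] 1)

lemma commutator_skew {A : Type} [Ring A] (x y : A) : ⁅x, y⁆ = -⁅y, x⁆ := by
  simp only [Ring.lie_def, neg_sub]

lemma commutator_self {A : Type} [Ring A] (x : A) : ⁅x, x⁆ = 0 := by
  rw [Ring.lie_def, sub_self]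

section General

variable {A : Type} [Ring A] [Algebra ℂ A]

lemma wedge_zero_left (x : A) : wedge 0 x = 0 := by
  simp [wedge]

lemma wedge_zero_right (x : A) : wedge x 0 = 0 := by
  simp [wedge]

@[simp] lemma emb12_tmul (x y : A) : emb12 A (x ⊗ₜ[ℂ] y) = (x ⊗ₜ[ℂ] y) ⊗ₜ[ℂ] 1 := rfl

@[simp] lemma emb13_tmul (x y : A) : emb13 A (x ⊗ₜ[ℂ] y) = (x ⊗ₜ[ℂ] 1) ⊗ₜ[ℂ] y := rfl

@[simp] lemma emb23_tmul (x y : A) : emb23 A (x ⊗ₜ[ℂ] y) = (1 ⊗ₜ[ℂ] x) ⊗ₜ[ℂ] y := rfl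

lemma cybe_iff_cybeBracket_self (r : A ⊗[ℂ] A) : CYBE A r ↔ cybeBracket r r = 0 := Iff.rfl

lemma cybeBracket_add_left (r r' s : A ⊗[ℂ] A) :
    cybeBracket (r + r') s = cybeBracket r s + cybeBracket r' s := by
  simp only [cybeBracket, map_add, add_mul, mul_add]; abel

lemma cybeBracket_add_right (r s s' : A ⊗[ℂ] A) :
    cybeBracket r (s + s') = cybeBracket r s + cybeBracket r s' := by
  simp only [cybeBracket, map_add, add_mul, mul_add]; abel

lemma cybeBracket_smul_left (c : ℂ) (r s : A ⊗[ℂ] A) :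
    cybeBracket (c • r) s = c • cybeBracket r s := by
  simp only [cybeBracket, map_smul, smul_mul_assoc, mul_smul_comm, smul_add, smul_sub]

lemma cybeBracket_smul_right (c : ℂ) (r s : A ⊗[ℂ] A) :
    cybeBracket r (c • s) = c • cybeBracket r s := by
  simp only [cybeBracket, map_smul, smul_mul_assoc, mul_smul_comm, smul_add, smul_sub]

lemma cybeBracket_sum_left {ι : Type} (t : Finset ι) (f : ι → A ⊗[ℂ] A) (s : A ⊗[ℂ] A) :
    cybeBracket (∑ i ∈ t, f i) s = ∑ i ∈ t, cybeBracket (f i) s :=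
  map_sum (AddMonoidHom.mk' (cybeBracket · s) fun _ _ => cybeBracket_add_left _ _ _) _ _

lemma cybeBracket_sum_right {ι : Type} (t : Finset ι) (f : ι → A ⊗[ℂ] A) (r : A ⊗[ℂ] A) :
    cybeBracket r (∑ i ∈ t, f i) = ∑ i ∈ t, cybeBracket r (f i) :=
  map_sum (AddMonoidHom.mk' (cybeBracket r) fun _ _ => cybeBracket_add_right _ _ _) _ _

lemma cybeBracket_tmul (a b c d : A) :
    cybeBracket (a ⊗ₜ[ℂ] b) (c ⊗ₜ[ℂ] d) =
      (⁅a, c⁆ ⊗ₜ[ℂ] b) ⊗ₜ[ℂ] d + (a ⊗ₜ[ℂ] ⁅b, c⁆) ⊗ₜ[ℂ] d + (a ⊗ₜ[ℂ] c) ⊗ₜ[ℂ] ⁅b, d⁆ := by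
  simp [cybeBracket, Ring.lie_def, sub_tmul, tmul_sub]

lemma cybeBracket_wedge (a b c d : A) :
    cybeBracket (wedge a b) (wedge c d) =
      cybeBracket (a ⊗ₜ[ℂ] b) (c ⊗ₜ[ℂ] d) - cybeBracket (a ⊗ₜ[ℂ] b) (d ⊗ₜ[ℂ] c)
      - cybeBracket (b ⊗ₜ[ℂ] a) (c ⊗ₜ[ℂ] d) + cybeBracket (b ⊗ₜ[ℂ] a) (d ⊗ₜ[ℂ] c) := by
  simp only [wedge, cybeBracket, map_sub, sub_mul, mul_sub]; abel

lemma adTensor_add (x : A) (u v : A ⊗[ℂ] A) :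
    adTensor x (u + v) = adTensor x u + adTensor x v := by
  simp only [adTensor, mul_add, add_mul]; abel

lemma adTensor_sum {ι : Type} (t : Finset ι) (f : ι → A ⊗[ℂ] A) (x : A) :
    adTensor x (∑ i ∈ t, f i) = ∑ i ∈ t, adTensor x (f i) :=
  map_sum (AddMonoidHom.mk' (adTensor x) (adTensor_add x)) _ _

lemma adTensor_wedge (x a b : A) :
    adTensor x (wedge a b) = wedge ⁅x, a⁆ b + wedge a ⁅x, b⁆ := by
  simp only [adTensor, wedge, Ring.lie_def, mul_sub, sub_mul, mul_add, add_mul,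
    Algebra.TensorProduct.tmul_mul_tmul, one_mul, mul_one, sub_tmul, tmul_sub]
  abel

lemma insertTensor_add (y : A) (u v : A ⊗[ℂ] A) :
    insertTensor y (u + v) = insertTensor y u + insertTensor y v := by
  simp only [insertTensor, map_add, add_mul]; abel

lemma insertTensor_sum {ι : Type} (t : Finset ι) (f : ι → A ⊗[ℂ] A) (y : A) :
    insertTensor y (∑ i ∈ t, f i) = ∑ i ∈ t, insertTensor y (f i) :=
  map_sum (AddMonoidHom.mk' (insertTensor y) (insertTensor_add y)) _ _

lemma insertTensor_zero (y : A) : insertTensor y 0 = 0 := by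
  simp [insertTensor]

lemma insertTensor_wedge (y a b : A) :
    insertTensor y (wedge a b) =
      (a ⊗ₜ[ℂ] b) ⊗ₜ[ℂ] y - (b ⊗ₜ[ℂ] a) ⊗ₜ[ℂ] y - (a ⊗ₜ[ℂ] y) ⊗ₜ[ℂ] b + (b ⊗ₜ[ℂ] y) ⊗ₜ[ℂ] a
      + (y ⊗ₜ[ℂ] a) ⊗ₜ[ℂ] b - (y ⊗ₜ[ℂ] b) ⊗ₜ[ℂ] a := by
  simp only [insertTensor, wedge, map_sub, sub_mul, emb12_tmul, emb13_tmul, emb23_tmul,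
    Algebra.TensorProduct.tmul_mul_tmul, one_mul, mul_one]
  abel

lemma cybeBracket_wedge_add_swap (x y a b : A) :
    cybeBracket (wedge x y) (wedge a b) + cybeBracket (wedge a b) (wedge x y) =
      insertTensor x (adTensor y (wedge a b)) - insertTensor y (adTensor x (wedge a b)) := by
  simp only [adTensor_wedge, insertTensor_add, insertTensor_wedge, cybeBracket_wedge,
    cybeBracket_tmul]
  rw [commutator_skew a x, commutator_skew a y, commutator_skew b x, commutator_skew b y]
  simp only [neg_tmul, tmul_neg]
  abel

lemma cybeBracket_wedge_add_swap_sum {ι : Type} (t : Finset ι) (a b : ι → A) (x y : A) :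
    cybeBracket (wedge x y) (∑ i ∈ t, wedge (a i) (b i)) +
        cybeBracket (∑ i ∈ t, wedge (a i) (b i)) (wedge x y) =
      insertTensor x (adTensor y (∑ i ∈ t, wedge (a i) (b i))) -
        insertTensor y (adTensor x (∑ i ∈ t, wedge (a i) (b i))) := by
  simp only [cybeBracket_sum_left, cybeBracket_sum_right, adTensor_sum, insertTensor_sum,
    ← Finset.sum_add_distrib, ← Finset.sum_sub_distrib, cybeBracket_wedge_add_swap]

/-- The cross terms vanish against a skew tensor which is invariant under `x` and `y`. -/
lemma cybeBracket_wedge_add_swap_eq_zero {ι : Type} (t : Finset ι) (a b : ι → A) (h e x y : A)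
    (hx : adTensor x (wedge h e + ∑ i ∈ t, wedge (a i) (b i)) = 0)
    (hy : adTensor y (wedge h e + ∑ i ∈ t, wedge (a i) (b i)) = 0) :
    cybeBracket (wedge x y) (wedge h e + ∑ i ∈ t, wedge (a i) (b i)) +
      cybeBracket (wedge h e + ∑ i ∈ t, wedge (a i) (b i)) (wedge x y) = 0 := by
  rw [cybeBracket_add_left, cybeBracket_add_right, add_add_add_comm, cybeBracket_wedge_add_swap,
    cybeBracket_wedge_add_swap_sum, sub_add_sub_comm, ← insertTensor_add, ← insertTensor_add,
    ← adTensor_add, ← adTensor_add, hx, hy, insertTensor_zero, insertTensor_zero, sub_zero]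

/-- The r-matrix of an extended Jordanian twist satisfies the classical Yang–Baxter equation. -/
lemma cybeBracket_extendedJordanian {ι : Type} [DecidableEq ι] (t : Finset ι) (a b : ι → A)
    (h e : A) (he : ⁅h, e⁆ = e)
    (ha : ∀ i ∈ t, ⁅h, a i⁆ = (1 / 2 : ℂ) • a i) (hb : ∀ i ∈ t, ⁅h, b i⁆ = (1 / 2 : ℂ) • b i)
    (hea : ∀ i ∈ t, ⁅e, a i⁆ = 0) (heb : ∀ i ∈ t, ⁅e, b i⁆ = 0)
    (haa : ∀ i ∈ t, ∀ j ∈ t, ⁅a i, a j⁆ = 0) (hbb : ∀ i ∈ t, ∀ j ∈ t, ⁅b i, b j⁆ = 0)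
    (hab : ∀ i ∈ t, ∀ j ∈ t, ⁅a i, b j⁆ = if i = j then e else 0) :
    cybeBracket (wedge h e + ∑ i ∈ t, wedge (a i) (b i))
      (wedge h e + ∑ i ∈ t, wedge (a i) (b i)) = 0 := by
  have hhe : cybeBracket (wedge h e) (wedge h e) = 0 := by
    have he' : ⁅e, h⁆ = -e := by rw [commutator_skew, he]
    simp only [cybeBracket_wedge, cybeBracket_tmul, he, he', commutator_self, neg_tmul, tmul_neg,
      zero_tmul, tmul_zero]
    abel
  have hcross : ∀ i ∈ t, cybeBracket (wedge h e) (wedge (a i) (b i)) +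
      cybeBracket (wedge (a i) (b i)) (wedge h e) +
      ∑ j ∈ t, cybeBracket (wedge (a i) (b i)) (wedge (a j) (b j)) = 0 := by
    intro i hi
    have hoff : ∀ j ∈ t, j ≠ i →
        cybeBracket (wedge (a i) (b i)) (wedge (a j) (b j)) = 0 := by
      intro j hj hji
      have h1 : ⁅a i, b j⁆ = 0 := by rw [hab i hi j hj, if_neg hji.symm]
      have h2 : ⁅b i, a j⁆ = 0 := by rw [commutator_skew, hab j hj i hi, if_neg hji, neg_zero]
      simp [cybeBracket_wedge, cybeBracket_tmul, h1, h2, haa i hi j hj, hbb i hi j hj]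
    have h1 : ⁅a i, b i⁆ = e := by rw [hab i hi i hi, if_pos rfl]
    have h2 : ⁅b i, a i⁆ = -e := by rw [commutator_skew, h1]
    rw [Finset.sum_eq_single_of_mem i hi hoff, cybeBracket_wedge_add_swap, adTensor_wedge,
      adTensor_wedge, ha i hi, hb i hi, hea i hi, heb i hi]
    simp only [insertTensor_add, insertTensor_wedge, cybeBracket_wedge, cybeBracket_tmul, h1, h2,
      commutator_self, neg_tmul, tmul_neg, zero_tmul, tmul_zero, ← smul_tmul', tmul_smul]
    module
  have hsum := Finset.sum_eq_zero hcross
  simp only [Finset.sum_add_distrib] at hsum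
  simp only [cybeBracket_add_left, cybeBracket_add_right, hhe, zero_add]
  rw [← hsum]
  simp only [cybeBracket_sum_left, cybeBracket_sum_right]
  rw [Finset.sum_comm (s := t) (t := t)]
  abel

end General

lemma eM_mul_eM_same {N b : ℕ} (hb : 1 ≤ b) (hb' : b ≤ 2 * N) (a d : ℕ) :
    eM N a b * eM N b d = eM N a d := by
  ext p q
  rw [Matrix.mul_apply, Finset.sum_eq_single (⟨b - 1, by omega⟩ : Fin (2 * N))]
  · simp [eM, Nat.sub_add_cancel hb, ← ite_and, and_comm]
  · intro j _ hj
    have : j.val + 1 ≠ b := fun h => hj (Fin.ext (by simp; omega))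
    simp [eM, this]
  · simp

lemma eM_mul_eM_of_ne {N b c : ℕ} (h : b ≠ c) (a d : ℕ) : eM N a b * eM N c d = 0 := by
  ext p q
  rw [Matrix.mul_apply]
  refine Finset.sum_eq_zero fun j _ => ?_
  simp only [eM, Matrix.of_apply]
  split_ifs <;> first | omega | simp

section Commutators

variable {N k i l m : ℕ}

lemma commutator_Hgen_Ep_self (hk : 1 ≤ k) (hkN : k ≤ N) : ⁅Hgen N k, Ep N k k⁆ = Ep N k k := by
  simp (disch := omega) only [Ring.lie_def, Hgen, Ep, mul_add, add_mul, sub_mul, mul_sub,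
    smul_mul_assoc, mul_smul_comm, eM_mul_eM_same, eM_mul_eM_of_ne]
  module

lemma commutator_Hgen_Em (hk : 1 ≤ k) (hki : k < i) (hiN : i ≤ N) :
    ⁅Hgen N k, Em N k i⁆ = (1 / 2 : ℂ) • Em N k i := by
  simp (disch := omega) only [Ring.lie_def, Hgen, Em, sub_mul, mul_sub,
    smul_mul_assoc, mul_smul_comm, eM_mul_eM_same, eM_mul_eM_of_ne]
  module

lemma commutator_Hgen_Ep (hk : 1 ≤ k) (hki : k < i) (hiN : i ≤ N) :
    ⁅Hgen N k, Ep N k i⁆ = (1 / 2 : ℂ) • Ep N k i := by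
  simp (disch := omega) only [Ring.lie_def, Hgen, Ep, mul_add, add_mul, sub_mul, mul_sub,
    smul_mul_assoc, mul_smul_comm, eM_mul_eM_same, eM_mul_eM_of_ne]
  module

lemma commutator_Ep_Ep (hk : k ≤ N) (hi : i ≤ N) (hk0 : 1 ≤ k) (hi0 : 1 ≤ i) (hl0 : 1 ≤ l)
    (hm0 : 1 ≤ m) (hl : l ≤ N) (hm : m ≤ N) : ⁅Ep N k i, Ep N l m⁆ = 0 := by
  simp (disch := omega) only [Ring.lie_def, Ep, mul_add, add_mul, eM_mul_eM_of_ne]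
  module

lemma commutator_Em_Em_left (hk : 1 ≤ k) (hki : k < i) (hiN : i ≤ N) (hkl : k < l) (hlN : l ≤ N) :
    ⁅Em N k i, Em N k l⁆ = 0 := by
  simp (disch := omega) only [Ring.lie_def, Em, mul_sub, sub_mul, eM_mul_eM_of_ne]
  module

lemma commutator_Ep_Em_self (hk : 1 ≤ k) (hki : k < i) (hiN : i ≤ N) :
    ⁅Ep N k k, Em N k i⁆ = 0 := by
  simp (disch := omega) only [Ring.lie_def, Ep, Em, mul_sub, sub_mul, add_mul, mul_add,
    eM_mul_eM_of_ne]
  module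

lemma commutator_Em_Ep (hk : 1 ≤ k) (hki : k < i) (hiN : i ≤ N) (hkl : k < l) (hlN : l ≤ N) :
    ⁅Em N k i, Ep N k l⁆ = if i = l then Ep N k k else 0 := by
  split_ifs with h
  · subst h
    simp (disch := omega) only [Ring.lie_def, Ep, Em, mul_sub, sub_mul, add_mul, mul_add,
      eM_mul_eM_same, eM_mul_eM_of_ne]
    module
  · simp (disch := omega) only [Ring.lie_def, Ep, Em, mul_sub, sub_mul, add_mul, mul_add,
      eM_mul_eM_of_ne]
    module

lemma commutator_Hgen_Em_of_lt (hk : 1 ≤ k) (hkl : k < l) (hlN : l ≤ N) (hki : k < i)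
    (hiN : i ≤ N) : ⁅Hgen N l, Em N k i⁆ = if l = i then -(1 / 2 : ℂ) • Em N k l else 0 := by
  split_ifs with h
  · subst h
    simp (disch := omega) only [Ring.lie_def, Hgen, Em, mul_sub, sub_mul,
      smul_mul_assoc, mul_smul_comm, eM_mul_eM_same, eM_mul_eM_of_ne]
    module
  · simp (disch := omega) only [Ring.lie_def, Hgen, Em, mul_sub, sub_mul,
      smul_mul_assoc, mul_smul_comm, eM_mul_eM_of_ne]
    module

lemma commutator_Hgen_Ep_of_lt (hk : 1 ≤ k) (hkl : k < l) (hlN : l ≤ N) (hki : k < i)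
    (hiN : i ≤ N) : ⁅Hgen N l, Ep N k i⁆ = if l = i then (1 / 2 : ℂ) • Ep N k l else 0 := by
  split_ifs with h
  · subst h
    simp (disch := omega) only [Ring.lie_def, Hgen, Ep, mul_sub, sub_mul, mul_add, add_mul,
      smul_mul_assoc, mul_smul_comm, eM_mul_eM_same, eM_mul_eM_of_ne]
    module
  · simp (disch := omega) only [Ring.lie_def, Hgen, Ep, mul_sub, sub_mul, mul_add, add_mul,
      smul_mul_assoc, mul_smul_comm, eM_mul_eM_of_ne]
    module

lemma commutator_Hgen_Hgen (hk : 1 ≤ k) (hkl : k < l) (hlN : l ≤ N) :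
    ⁅Hgen N l, Hgen N k⁆ = 0 := by
  simp (disch := omega) only [Ring.lie_def, Hgen, mul_sub, sub_mul, smul_mul_assoc,
    mul_smul_comm, eM_mul_eM_of_ne]
  module

lemma commutator_Hgen_Ep_self_of_lt (hk : 1 ≤ k) (hkl : k < l) (hlN : l ≤ N) :
    ⁅Hgen N l, Ep N k k⁆ = 0 := by
  simp (disch := omega) only [Ring.lie_def, Hgen, Ep, mul_sub, sub_mul, mul_add, add_mul,
    smul_mul_assoc, mul_smul_comm, eM_mul_eM_of_ne]
  module

lemma commutator_Em_Hgen_of_lt (hk : 1 ≤ k) (hkl : k < l) (hlm : l < m) (hmN : m ≤ N) :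
    ⁅Em N l m, Hgen N k⁆ = 0 := by
  simp (disch := omega) only [Ring.lie_def, Hgen, Em, mul_sub, sub_mul,
    smul_mul_assoc, mul_smul_comm, eM_mul_eM_of_ne]
  module

lemma commutator_Em_Ep_self_of_lt (hk : 1 ≤ k) (hkl : k < l) (hlm : l < m) (hmN : m ≤ N) :
    ⁅Em N l m, Ep N k k⁆ = 0 := by
  simp (disch := omega) only [Ring.lie_def, Ep, Em, mul_sub, sub_mul, mul_add, add_mul,
    eM_mul_eM_of_ne]
  module

lemma commutator_Em_Em_of_lt (hk : 1 ≤ k) (hkl : k < l) (hlm : l < m) (hmN : m ≤ N)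
    (hki : k < i) (hiN : i ≤ N) :
    ⁅Em N l m, Em N k i⁆ = if l = i then -Em N k m else 0 := by
  split_ifs with h
  · subst h
    simp (disch := omega) only [Ring.lie_def, Em, mul_sub, sub_mul,
      eM_mul_eM_same, eM_mul_eM_of_ne]
    module
  · simp (disch := omega) only [Ring.lie_def, Em, mul_sub, sub_mul, eM_mul_eM_of_ne]
    module

lemma commutator_Em_Ep_of_lt (hk : 1 ≤ k) (hkl : k < l) (hlm : l < m) (hmN : m ≤ N)
    (hki : k < i) (hiN : i ≤ N) :
    ⁅Em N l m, Ep N k i⁆ = if m = i then Ep N k l else 0 := by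
  split_ifs with h
  · subst h
    simp (disch := omega) only [Ring.lie_def, Ep, Em, mul_sub, sub_mul, mul_add, add_mul,
      eM_mul_eM_same, eM_mul_eM_of_ne]
    module
  · simp (disch := omega) only [Ring.lie_def, Ep, Em, mul_sub, sub_mul, mul_add, add_mul,
      eM_mul_eM_of_ne]
    module

lemma commutator_Ep_Hgen_of_lt (hk : 1 ≤ k) (hkl : k < l) (hlm : l ≤ m) (hmN : m ≤ N) :
    ⁅Ep N l m, Hgen N k⁆ = 0 := by
  simp (disch := omega) only [Ring.lie_def, Hgen, Ep, mul_sub, sub_mul, mul_add, add_mul,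
    smul_mul_assoc, mul_smul_comm, eM_mul_eM_of_ne]
  module

lemma commutator_Ep_Em_of_lt (hk : 1 ≤ k) (hkl : k < l) (hlm : l ≤ m) (hmN : m ≤ N)
    (hki : k < i) (hiN : i ≤ N) :
    ⁅Ep N l m, Em N k i⁆ = -((if m = i then Ep N k l else 0) + if l = i then Ep N k m else 0) := by
  split_ifs with h h' h' <;> (try subst h) <;> (try subst h') <;>
  · simp (disch := omega) only [Ring.lie_def, Ep, Em, mul_sub, sub_mul, mul_add, add_mul,
      eM_mul_eM_same, eM_mul_eM_of_ne]
    module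

end Commutators

/-- The `k`-th link of the full chain of r-matrices for `sp(N,ℂ)`. -/
noncomputable def chainLink (N k : ℕ) :
    Matrix (Fin (2*N)) (Fin (2*N)) ℂ ⊗[ℂ] Matrix (Fin (2*N)) (Fin (2*N)) ℂ :=
  wedge (Hgen N k) (Ep N k k) + ∑ i ∈ Finset.Ioc k N, wedge (Em N k i) (Ep N k i)

section ChainLink

variable {N k l m : ℕ}

lemma cybeBracket_chainLink_self (hk : 1 ≤ k) (hkN : k ≤ N) :
    cybeBracket (chainLink N k) (chainLink N k) = 0 := by
  apply cybeBracket_extendedJordanian _ _ _ _ _ (commutator_Hgen_Ep_self hk hkN)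
  all_goals
    intro i hi
    obtain ⟨hki, hiN⟩ := Finset.mem_Ioc.mp hi
  · exact commutator_Hgen_Em hk hki hiN
  · exact commutator_Hgen_Ep hk hki hiN
  · exact commutator_Ep_Em_self hk hki hiN
  · apply commutator_Ep_Ep <;> omega
  all_goals
    intro j hj
    obtain ⟨hkj, hjN⟩ := Finset.mem_Ioc.mp hj
  · exact commutator_Em_Em_left hk hki hiN hkj hjN
  · apply commutator_Ep_Ep <;> omega
  · exact commutator_Em_Ep hk hki hiN hkj hjN

lemma adTensor_Hgen_chainLink (hk : 1 ≤ k) (hkl : k < l) (hlN : l ≤ N) :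
    adTensor (Hgen N l) (chainLink N k) = 0 := by
  rw [chainLink, adTensor_add, adTensor_sum, adTensor_wedge, commutator_Hgen_Hgen hk hkl hlN,
    commutator_Hgen_Ep_self_of_lt hk hkl hlN, wedge_zero_left, wedge_zero_right, add_zero, zero_add]
  refine Finset.sum_eq_zero fun i hi => ?_
  obtain ⟨hki, hiN⟩ := Finset.mem_Ioc.mp hi
  rw [adTensor_wedge, commutator_Hgen_Em_of_lt hk hkl hlN hki hiN,
    commutator_Hgen_Ep_of_lt hk hkl hlN hki hiN]
  split_ifs with h
  · subst h
    simp only [wedge, ← smul_tmul', tmul_smul]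
    module
  · rw [wedge_zero_left, wedge_zero_right, add_zero]

lemma adTensor_Em_chainLink (hk : 1 ≤ k) (hkl : k < l) (hlm : l < m) (hmN : m ≤ N) :
    adTensor (Em N l m) (chainLink N k) = 0 := by
  have hsum : ∀ i ∈ Finset.Ioc k N, adTensor (Em N l m) (wedge (Em N k i) (Ep N k i)) =
      (if l = i then -wedge (Em N k m) (Ep N k l) else 0) +
        if m = i then wedge (Em N k m) (Ep N k l) else 0 := by
    intro i hi
    obtain ⟨hki, hiN⟩ := Finset.mem_Ioc.mp hi
    rw [adTensor_wedge, commutator_Em_Em_of_lt hk hkl hlm hmN hki hiN,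
      commutator_Em_Ep_of_lt hk hkl hlm hmN hki hiN]
    congr 1 <;> split_ifs with h <;> (try subst h) <;>
      simp [wedge, neg_tmul, tmul_neg, neg_add_eq_sub]
  rw [chainLink, adTensor_add, adTensor_sum, adTensor_wedge,
    commutator_Em_Hgen_of_lt hk hkl hlm hmN, commutator_Em_Ep_self_of_lt hk hkl hlm hmN,
    wedge_zero_left, wedge_zero_right, add_zero, zero_add, Finset.sum_congr rfl hsum, Finset.sum_add_distrib, Finset.sum_ite_eq,
    Finset.sum_ite_eq, if_pos (Finset.mem_Ioc.mpr ⟨hkl, by omega⟩),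
    if_pos (Finset.mem_Ioc.mpr ⟨by omega, hmN⟩), neg_add_cancel]

lemma adTensor_Ep_chainLink (hk : 1 ≤ k) (hkl : k < l) (hlm : l ≤ m) (hmN : m ≤ N) :
    adTensor (Ep N l m) (chainLink N k) = 0 := by
  have hsum : ∀ i ∈ Finset.Ioc k N, adTensor (Ep N l m) (wedge (Em N k i) (Ep N k i)) =
      (if m = i then -wedge (Ep N k l) (Ep N k m) else 0) +
        if l = i then wedge (Ep N k l) (Ep N k m) else 0 := by
    intro i hi
    obtain ⟨hki, hiN⟩ := Finset.mem_Ioc.mp hi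
    rw [adTensor_wedge, commutator_Ep_Em_of_lt hk hkl hlm hmN hki hiN,
      commutator_Ep_Ep (by omega) (by omega) (by omega) (by omega) (by omega) (by omega)
        (by omega) (by omega), wedge_zero_right, add_zero]
    split_ifs with h h' h' <;> (try subst h) <;> (try subst h') <;>
      simp only [wedge, neg_tmul, tmul_neg, neg_add, add_tmul, tmul_add, neg_zero, zero_tmul,
        tmul_zero] <;> abel
  rw [chainLink, adTensor_add, adTensor_sum, adTensor_wedge,
    commutator_Ep_Hgen_of_lt hk hkl hlm hmN,
    commutator_Ep_Ep (by omega) (by omega) (by omega) (by omega) (by omega) (by omega)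
      (by omega) (by omega), wedge_zero_left, wedge_zero_right, add_zero,
    zero_add, Finset.sum_congr rfl hsum, Finset.sum_add_distrib, Finset.sum_ite_eq,
    Finset.sum_ite_eq, if_pos (Finset.mem_Ioc.mpr ⟨by omega, hmN⟩),
    if_pos (Finset.mem_Ioc.mpr ⟨hkl, by omega⟩), neg_add_cancel]

lemma cybeBracket_chainLink_add_swap (hk : 1 ≤ k) (hkl : k < l) (hlN : l ≤ N) :
    cybeBracket (chainLink N k) (chainLink N l) +
      cybeBracket (chainLink N l) (chainLink N k) = 0 := by
  have hH : cybeBracket (wedge (Hgen N l) (Ep N l l)) (chainLink N k) +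
      cybeBracket (chainLink N k) (wedge (Hgen N l) (Ep N l l)) = 0 :=
    cybeBracket_wedge_add_swap_eq_zero _ _ _ _ _ _ _ (adTensor_Hgen_chainLink hk hkl hlN)
      (adTensor_Ep_chainLink hk hkl le_rfl hlN)
  have hE := Finset.sum_eq_zero (s := Finset.Ioc l N) (f := fun i =>
      cybeBracket (wedge (Em N l i) (Ep N l i)) (chainLink N k) +
        cybeBracket (chainLink N k) (wedge (Em N l i) (Ep N l i))) fun i hi => by
    obtain ⟨hli, hiN⟩ := Finset.mem_Ioc.mp hi
    exact cybeBracket_wedge_add_swap_eq_zero _ _ _ _ _ _ _ (adTensor_Em_chainLink hk hkl hli hiN)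
      (adTensor_Ep_chainLink hk hkl hli.le hiN)
  rw [Finset.sum_add_distrib, ← cybeBracket_sum_left, ← cybeBracket_sum_right] at hE
  rw [chainLink.eq_def N l, cybeBracket_add_left, cybeBracket_add_right, add_comm,
    add_add_add_comm, hH, hE, add_zero]

end ChainLink

/-- the classical r-matrix of the full chain of extended twists for `sp(3,ℂ)`,
`r = Σ_{k=1}^{3} η_k (H_{kk} ∧ E_{k+k} + Σ_{i=k+1}^{3} E_{k−i} ∧ E_{k+i})`,
satisfies the classical Yang–Baxter equation in `M₆(ℂ)⊗M₆(ℂ)⊗M₆(ℂ)`. -/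
theorem sp3_full_chain_r_matrix_CYBE (η₁ η₂ η₃ : ℂ) :
    CYBE (Matrix (Fin (2*3)) (Fin (2*3)) ℂ)
      (η₁ • (wedge (Hgen 3 1) (Ep 3 1 1) +
              (wedge (Em 3 1 2) (Ep 3 1 2) + wedge (Em 3 1 3) (Ep 3 1 3))) +
       η₂ • (wedge (Hgen 3 2) (Ep 3 2 2) + wedge (Em 3 2 3) (Ep 3 2 3)) +
       η₃ • wedge (Hgen 3 3) (Ep 3 3 3)) := by
  have h1 : wedge (Hgen 3 1) (Ep 3 1 1) +
      (wedge (Em 3 1 2) (Ep 3 1 2) + wedge (Em 3 1 3) (Ep 3 1 3)) = chainLink 3 1 := by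
    rw [chainLink, show Finset.Ioc 1 3 = {2, 3} from rfl, Finset.sum_pair (by decide)]
  have h2 : wedge (Hgen 3 2) (Ep 3 2 2) + wedge (Em 3 2 3) (Ep 3 2 3) = chainLink 3 2 := by
    rw [chainLink, show Finset.Ioc 2 3 = {3} from rfl, Finset.sum_singleton]
  have h3 : wedge (Hgen 3 3) (Ep 3 3 3) = chainLink 3 3 := by
    rw [chainLink, Finset.Ioc_self, Finset.sum_empty, add_zero]
  rw [h1, h2, h3, cybe_iff_cybeBracket_self]
  have swap {k l : ℕ} (hk : 1 ≤ k) (hkl : k < l) (hl : l ≤ 3) :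
      cybeBracket (chainLink 3 l) (chainLink 3 k) = -cybeBracket (chainLink 3 k) (chainLink 3 l) :=
    eq_neg_of_add_eq_zero_right (cybeBracket_chainLink_add_swap hk hkl hl)
  simp only [cybeBracket_add_left, cybeBracket_add_right, cybeBracket_smul_left,
    cybeBracket_smul_right, cybeBracket_chainLink_self (N := 3) (k := 1) le_rfl (by decide),
    cybeBracket_chainLink_self (N := 3) (k := 2) (by decide) (by decide),
    cybeBracket_chainLink_self (N := 3) (k := 3) (by decide) le_rfl,
    swap (k := 1) (l := 2) le_rfl (by decide) (by decide),
    swap (k := 1) (l := 3) le_rfl (by decide) (by decide),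
    swap (k := 2) (l := 3) (by decide) (by decide) le_rfl]
  module
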